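/- Let m ≥ 1. For all M, N ∈ p, the matrix commutator ⁅M, N⁆ = M*N - N*M lies in k, where k = {σ0⊗A + σ3⊗B : A ∈ su(m), B ∈ u(m)} and p = {σ1⊗A + σ2⊗B : A, B ∈ u(m)}. -/

import Mathlib

open Matrix Kronecker Complex

noncomputable section

/-- The 2×2 identity matrix (σ₀). -/
def σ0 : Matrix (Fin 2) (Fin 2) ℂ := 1
/-- Pauli matrix σ₁. -/
def σ1 : Matrix (Fin 2) (Fin 2) ℂ := !![0, 1; 1, 0]
/-- Pauli matrix σ₂. -/
def σ2 : Matrix (Fin 2) (Fin 2) ℂ := !![0, -Complex.I; Complex.I, 0]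
/-- Pauli matrix σ₃. -/
def σ3 : Matrix (Fin 2) (Fin 2) ℂ := !![1, 0; 0, -1]

/-- su(m): traceless skew-Hermitian m×m complex matrices. -/
def su (m : ℕ) : Set (Matrix (Fin m) (Fin m) ℂ) :=
  {A | A.trace = 0 ∧ Aᴴ = -A}

/-- u(m): skew-Hermitian m×m complex matrices. -/
def uAlg (m : ℕ) : Set (Matrix (Fin m) (Fin m) ℂ) :=
  {A | Aᴴ = -A}

/-- t(m): diagonal m×m matrices with purely imaginary diagonal entries. -/
def tAlg (m : ℕ) : Set (Matrix (Fin m) (Fin m) ℂ) :=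
  {A | ∃ d : Fin m → ℝ, A = Matrix.diagonal fun i => (d i : ℂ) * Complex.I}

/-- k = {σ0⊗A + σ3⊗B : A ∈ su(m), B ∈ u(m)}. -/
def kSet (m : ℕ) : Set (Matrix (Fin 2 × Fin m) (Fin 2 × Fin m) ℂ) :=
  {M | ∃ A ∈ su m, ∃ B ∈ uAlg m, M = σ0 ⊗ₖ A + σ3 ⊗ₖ B}


/-- p = {σ1⊗A + σ2⊗B : A, B ∈ u(m)}. -/
def pSet (m : ℕ) : Set (Matrix (Fin 2 × Fin m) (Fin 2 × Fin m) ℂ) :=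
  {M | ∃ A ∈ uAlg m, ∃ B ∈ uAlg m, M = σ1 ⊗ₖ A + σ2 ⊗ₖ B}

theorem lie_mem_su {m : ℕ} {A B : Matrix (Fin m) (Fin m) ℂ}
    (hA : A ∈ uAlg m) (hB : B ∈ uAlg m) : A * B - B * A ∈ su m := by
  simp only [uAlg, Set.mem_ofPred_eq] at hA hB
  constructor
  · rw [trace_sub, trace_mul_comm, sub_self]
  · simp only [conjTranspose_sub, conjTranspose_mul, hA, hB]
    noncomm_ring

theorem I_smul_anticommutator_mem_uAlg {m : ℕ} {A B : Matrix (Fin m) (Fin m) ℂ}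
    (hA : A ∈ uAlg m) (hB : B ∈ uAlg m) : Complex.I • (A * B + B * A) ∈ uAlg m := by
  simp only [uAlg, Set.mem_ofPred_eq] at hA hB ⊢
  simp [conjTranspose_smul, conjTranspose_mul, hA, hB, add_comm]

theorem add_mem_su {m : ℕ} {A B : Matrix (Fin m) (Fin m) ℂ}
    (hA : A ∈ su m) (hB : B ∈ su m) : A + B ∈ su m :=
  ⟨by rw [trace_add, hA.1, hB.1, add_zero],
    by rw [conjTranspose_add, hA.2, hB.2, neg_add]⟩

theorem sub_mem_uAlg {m : ℕ} {A B : Matrix (Fin m) (Fin m) ℂ}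
    (hA : A ∈ uAlg m) (hB : B ∈ uAlg m) : A - B ∈ uAlg m := by
  simp only [uAlg, Set.mem_ofPred_eq] at hA hB ⊢
  rw [conjTranspose_sub, hA, hB, neg_sub_neg, neg_sub]

theorem σ1_mul_σ1 : σ1 * σ1 = σ0 := by
  simp [σ0, σ1, one_fin_two]

theorem σ2_mul_σ2 : σ2 * σ2 = σ0 := by
  simp [σ0, σ2, one_fin_two]

theorem σ1_mul_σ2 : σ1 * σ2 = Complex.I • σ3 := by
  simp [σ1, σ2, σ3]

theorem σ2_mul_σ1 : σ2 * σ1 = -(Complex.I • σ3) := by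
  simp [σ1, σ2, σ3]

/-- ⁅p, p⁆ ⊆ k. -/
theorem p_bracket_p_mem_k (m : ℕ) (hm : 1 ≤ m)
    (M N : Matrix (Fin 2 × Fin m) (Fin 2 × Fin m) ℂ)
    (hM : M ∈ pSet m) (hN : N ∈ pSet m) :
    ⁅M, N⁆ ∈ kSet m := by
  obtain ⟨A, hA, B, hB, rfl⟩ := hM
  obtain ⟨C, hC, D, hD, rfl⟩ := hN
  refine ⟨_, add_mem_su (lie_mem_su hA hC) (lie_mem_su hB hD), _,
    sub_mem_uAlg (I_smul_anticommutator_mem_uAlg hA hD)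
      (I_smul_anticommutator_mem_uAlg hB hC), ?_⟩
  simp only [Ring.lie_def, add_mul, mul_add, ← mul_kronecker_mul, σ1_mul_σ1, σ2_mul_σ2,
    σ1_mul_σ2, σ2_mul_σ1]
  ext ⟨i, k⟩ ⟨j, l⟩
  simp only [Matrix.add_apply, Matrix.sub_apply, Matrix.neg_apply, Matrix.smul_apply,
    kronecker_apply, smul_eq_mul]
  ring
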